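/- Let Φ be a recurrent CH system on V with eigenvalue sequence {θ_i}_{i=0}^d and dual eigenvalue sequence {θ*_i}_{i=0}^d. Then ∏_{i=2}^{d−1} (θ_0 − θ_{i+1})/(θ_1 − θ_i) = 1 and ∏_{i=2}^{d−1} (θ*_0 − θ*_{i+1})/(θ*_1 − θ*_i) = 1. -/

import Mathlib

open Polynomial Finset Module

variable {F V : Type*} [Field F] [AddCommGroup V] [Module F V]

/-- The primitive idempotent of `A` for the eigenvalue `θ i`, where the eigenvalues of `A`
are `θ 0, …, θ d`. -/
noncomputable def primIdem (d : ℕ) (A : Module.End F V) (θ : ℕ → F) (i : ℕ) :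
    Module.End F V :=
  Polynomial.aeval A (∏ j ∈ (Finset.range (d+1)).erase i,
    (Polynomial.C (θ i - θ j)⁻¹ * (Polynomial.X - Polynomial.C (θ j))))

/-- A sequence `σ 0, …, σ n` is `β`-recurrent. -/
def BetaRecurrent (β : F) (n : ℕ) (σ : ℕ → F) : Prop :=
  ∀ i, 2 ≤ i → i + 1 ≤ n → σ (i-2) - (β+1) * σ (i-1) + (β+1) * σ i - σ (i+1) = 0

/-- The scalars ϑ_i attached to eigenvalue data `θ, θs` and a split sequence `φ`:
`ϑ 0 = 0`, `ϑ (d+1) = 0` and `ϑ i = φ i - (θs i - θs 0)(θ (d-i+1) - θ 0)` for `1 ≤ i ≤ d`. -/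
def vth (d : ℕ) (θ θs φ : ℕ → F) (i : ℕ) : F :=
  if 1 ≤ i ∧ i ≤ d then φ i - (θs i - θs 0) * (θ (d - i + 1) - θ 0) else 0

/-- `φ 1, …, φ d` is the split sequence for `(A, As)` with eigenvalue data `θ, θs`:
there is a (split) basis `v 0, …, v d` of `V` on which `A, As` act in the prescribed way. -/
def SplitSeq (d : ℕ) (A As : Module.End F V) (θ θs φ : ℕ → F) : Prop :=
  ∃ v : ℕ → V,
    LinearIndependent F (fun i : Fin (d+1) => v i) ∧
    Submodule.span F (v '' Set.Iic d) = ⊤ ∧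
    (∀ i < d, A (v i) = θ (d - i) • v i + v (i+1)) ∧
    A (v d) = θ 0 • v d ∧
    As (v 0) = θs 0 • v 0 ∧
    (∀ i, 1 ≤ i → i ≤ d → As (v i) = θs i • v i + φ i • v (i-1))

/-- A circular Hessenberg system on `V` of diameter `d`. -/
structure CHSystem (F V : Type*) [Field F] [AddCommGroup V] [Module F V] (d : ℕ) where
  A : Module.End F V
  As : Module.End F V
  θ : ℕ → F
  θs : ℕ → F
  θ_inj : ∀ i ≤ d, ∀ j ≤ d, θ i = θ j → i = j
  θs_inj : ∀ i ≤ d, ∀ j ≤ d, θs i = θs j → i = j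
  A_ann : Polynomial.aeval A (∏ j ∈ Finset.range (d+1), (Polynomial.X - Polynomial.C (θ j))) = 0
  As_ann : Polynomial.aeval As (∏ j ∈ Finset.range (d+1), (Polynomial.X - Polynomial.C (θs j))) = 0
  A_eig : ∀ i ≤ d, Module.End.HasEigenvalue A (θ i)
  As_eig : ∀ i ≤ d, Module.End.HasEigenvalue As (θs i)
  circ₁ : ∀ i ≤ d, ∀ j ≤ d, ((j:ℤ) + 1 < (i:ℤ) ∨ (1 < (j:ℤ) - (i:ℤ) ∧ (j:ℤ) - (i:ℤ) < (d:ℤ))) →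
      primIdem d A θ i * As * primIdem d A θ j = 0
  circ₂ : ∀ i ≤ d, ∀ j ≤ d, ((i:ℤ) = (j:ℤ) + 1 ∨ (j:ℤ) = (i:ℤ) + (d:ℤ)) →
      primIdem d A θ i * As * primIdem d A θ j ≠ 0
  circ₃ : ∀ i ≤ d, ∀ j ≤ d, ((j:ℤ) + 1 < (i:ℤ) ∨ (1 < (j:ℤ) - (i:ℤ) ∧ (j:ℤ) - (i:ℤ) < (d:ℤ))) →
      primIdem d As θs i * A * primIdem d As θs j = 0
  circ₄ : ∀ i ≤ d, ∀ j ≤ d, ((i:ℤ) = (j:ℤ) + 1 ∨ (j:ℤ) = (i:ℤ) + (d:ℤ)) →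
      primIdem d As θs i * A * primIdem d As θs j ≠ 0

/-- The `β`-recurrent sequence with `σ 0 = 0`, `σ 1 = 1` whose backward extension has `σ (-1) = 0`. -/
def betaSeq (β : F) : ℕ → F
  | 0 => 0
  | 1 => 1
  | n + 2 => β * betaSeq β (n + 1) - betaSeq β n + 1

lemma betaSeq_add_two (β : F) (n : ℕ) :
    betaSeq β (n + 2) = β * betaSeq β (n + 1) - betaSeq β n + 1 := rfl

lemma betaSeq_invariant (β : F) (n : ℕ) :
    betaSeq β (n + 1) ^ 2 - β * betaSeq β (n + 1) * betaSeq β n + betaSeq β n ^ 2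
      - betaSeq β (n + 1) - betaSeq β n = 0 := by
  induction n with
  | zero => simp [betaSeq]
  | succ n ih =>
    rw [betaSeq_add_two]
    linear_combination ih

lemma betaSeq_mul_add_two (β : F) (n : ℕ) :
    betaSeq β n * betaSeq β (n + 2) = betaSeq β (n + 1) ^ 2 - betaSeq β (n + 1) := by
  rw [betaSeq_add_two]
  linear_combination -betaSeq_invariant β n

namespace BetaRecurrent

variable {β : F} {N : ℕ} {σ : ℕ → F}

lemma eq_betaSeq (h : BetaRecurrent β N σ) (n : ℕ) (hn : n + 1 ≤ N) :
    σ (n + 1) = σ 0 + (σ 1 - σ 0) * betaSeq β (n + 1)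
      + (σ 2 - σ 0 - (β + 1) * (σ 1 - σ 0)) * betaSeq β n := by
  induction n using Nat.strong_induction_on with
  | _ n ih =>
    match n with
    | 0 => simp [betaSeq]
    | 1 => simp [betaSeq]; ring
    | 2 =>
      have h0 := h 2 le_rfl hn
      simp only [Nat.sub_self, Nat.add_one_sub_one, Nat.reduceAdd] at h0
      simp only [betaSeq, Nat.reduceAdd]
      linear_combination -h0
    | m + 3 =>
      have h0 := h (m + 3) (by omega) hn
      rw [show m + 3 - 2 = m + 1 by omega, show m + 3 - 1 = m + 1 + 1 by omega,
        show m + 3 = m + 2 + 1 by omega, ih m (by omega) (by omega),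
        ih (m + 1) (by omega) (by omega), ih (m + 2) (by omega) (by omega)] at h0
      rw [show m + 3 + 1 = m + 2 + 1 + 1 by omega]
      simp only [betaSeq] at h0 ⊢
      linear_combination -h0

lemma betaSeq_mul_sub (h : BetaRecurrent β N σ) (n : ℕ) (hn : n + 2 ≤ N) :
    betaSeq β (n + 1) * (σ 1 - σ (n + 1)) = betaSeq β n * (σ 0 - σ (n + 2)) := by
  rw [h.eq_betaSeq n (by omega), h.eq_betaSeq (n + 1) hn]
  linear_combination (σ 1 - σ 0) * betaSeq_mul_add_two β n

lemma betaSeq_ne_zero (h : BetaRecurrent β N σ)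
    (hinj : ∀ i ≤ N, ∀ j ≤ N, σ i = σ j → i = j) (n : ℕ) (hn : n + 2 ≤ N) :
    betaSeq β (n + 1) ≠ 0 := by
  induction n with
  | zero => simp [betaSeq]
  | succ n ih =>
    intro h0
    have h1 := h.betaSeq_mul_sub (n + 1) hn
    rw [h0, zero_mul, eq_comm, mul_eq_zero, sub_eq_zero] at h1
    rcases h1 with h1 | h1
    · exact ih (by omega) h1
    · have := hinj _ (by omega) _ (by omega) h1
      omega

lemma prod_div_eq_betaSeq (h : BetaRecurrent β N σ)
    (hinj : ∀ i ≤ N, ∀ j ≤ N, σ i = σ j → i = j) (n : ℕ) (hn : n + 2 ≤ N) :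
    ∏ i ∈ Finset.Icc 2 (n + 1), (σ 0 - σ (i + 1)) / (σ 1 - σ i) = betaSeq β (n + 1) := by
  induction n with
  | zero => simp [betaSeq]
  | succ n ih =>
    have hne : σ 1 - σ (n + 2) ≠ 0 := fun h0 => by
      have := hinj _ (by omega) _ (by omega) (sub_eq_zero.1 h0)
      omega
    rw [Finset.prod_Icc_succ_top (by omega), ih (by omega), ← mul_div_assoc, div_eq_iff hne]
    exact (h.betaSeq_mul_sub (n + 1) hn).symm

end BetaRecurrent

lemma primIdem_eq_aeval_basis (d : ℕ) (A : Module.End F V) (θ : ℕ → F) (i : ℕ) :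
    primIdem d A θ i = aeval A (Lagrange.basis (Finset.range (d + 1)) θ i) := rfl

lemma sum_primIdem {d : ℕ} {θ : ℕ → F} (A : Module.End F V)
    (hinj : ∀ i ≤ d, ∀ j ≤ d, θ i = θ j → i = j) :
    ∑ j ∈ Finset.range (d + 1), primIdem d A θ j = 1 := by
  simp only [primIdem_eq_aeval_basis]
  rw [← map_sum, Lagrange.sum_basis, map_one]
  · intro i hi j hj hij
    simp only [Finset.coe_range, Set.mem_Iio] at hi hj
    exact hinj i (by omega) j (by omega) hij
  · exact ⟨0, by simp⟩

lemma primIdem_mul {d : ℕ} {A : Module.End F V} {θ : ℕ → F}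
    (hA : aeval A (∏ j ∈ Finset.range (d + 1), (X - C (θ j))) = 0) {i : ℕ} (hi : i ≤ d) :
    primIdem d A θ i * A = θ i • primIdem d A θ i := by
  have hmul : primIdem d A θ i * aeval A (X - C (θ i)) = 0 := by
    rw [primIdem, ← map_mul, Finset.prod_mul_distrib, mul_assoc, Finset.prod_erase_mul, map_mul,
      hA, mul_zero]
    simp only [Finset.mem_range]
    omega
  rw [map_sub, aeval_X, aeval_C, mul_sub, sub_eq_zero] at hmul
  rw [hmul, ← Algebra.commutes, Algebra.smul_def]

namespace CHSystem

variable {d : ℕ} (Φ : CHSystem F V d)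

lemma primIdem_apply_A {i : ℕ} (hi : i ≤ d) (x : V) :
    primIdem d Φ.A Φ.θ i (Φ.A x) = Φ.θ i • primIdem d Φ.A Φ.θ i x :=
  LinearMap.congr_fun (primIdem_mul Φ.A_ann hi) x

/-- The nonvanishing of `E₀ A* E_d`, expressed in terms of the split sequence. -/
lemma vth_ne (hd : 3 ≤ d) {φ : ℕ → F} (hsplit : SplitSeq d Φ.A Φ.As Φ.θ Φ.θs φ) :
    (Φ.θ d - Φ.θ 0 + Φ.θ (d - 1) - Φ.θ 1) * vth d Φ.θ Φ.θs φ 1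
      + (Φ.θ 0 - Φ.θ d) * vth d Φ.θ Φ.θs φ 2 ≠ 0 := by
  obtain ⟨v, -, hspan, hA, -, hAs0, hAs⟩ := hsplit
  intro hz
  set E := primIdem d Φ.A Φ.θ with hE
  have hEA : ∀ i ≤ d, ∀ x, E i (Φ.A x) = Φ.θ i • E i x := fun i hi x => Φ.primIdem_apply_A hi x
  have hstep : ∀ j ≤ d, ∀ i < d, E j (v (i + 1)) = (Φ.θ j - Φ.θ (d - i)) • E j (v i) := by
    intro j hj i hi
    have h1 := hEA j hj (v i)
    rw [hA i hi, map_add, map_smul] at h1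
    rw [sub_smul, ← h1, add_sub_cancel_left]
  have hEd : ∀ i < d, E d (v (i + 1)) = 0 := by
    intro i hi
    induction i with
    | zero => simp [hstep d le_rfl 0 hi]
    | succ i ih => rw [hstep d le_rfl _ hi, ih (by omega), smul_zero]
  have hne := Φ.circ₂ 0 (by omega) d le_rfl (Or.inr (by simp))
  refine hne (LinearMap.ext_on hspan ?_)
  rintro _ ⟨i, hi, rfl⟩
  rw [← hE, LinearMap.zero_apply, Module.End.mul_apply, Module.End.mul_apply]
  obtain _ | i := i
  swap
  · rw [hEd i hi, map_zero, map_zero]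
  set w := Φ.A (Φ.A (v 0) - Φ.θ 0 • v 0) - Φ.θ 1 • (Φ.A (v 0) - Φ.θ 0 • v 0) with hw
  have hEw : ∀ j ≤ d, E j w = ((Φ.θ j - Φ.θ 1) * (Φ.θ j - Φ.θ 0)) • E j (v 0) := by
    intro j hj
    simp only [hw, map_sub, map_smul, hEA j hj]
    module
  have hsum : E 0 (Φ.As w) =
      ((Φ.θ d - Φ.θ 1) * (Φ.θ d - Φ.θ 0)) • E 0 (Φ.As (E d (v 0))) := by
    have h1 : w = ∑ j ∈ Finset.range (d + 1), E j w := by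
      rw [← LinearMap.sum_apply, sum_primIdem Φ.A Φ.θ_inj, Module.End.one_apply]
    rw [h1, map_sum, map_sum, Finset.sum_eq_single d]
    · rw [hEw d le_rfl, map_smul, map_smul]
    · intro j hj hjd
      have hj' : j < d := by have := Finset.mem_range.1 hj; omega
      rw [hEw j hj'.le, map_smul, map_smul]
      rcases Nat.lt_or_ge 1 j with h | h
      · have h0 := LinearMap.congr_fun
          (Φ.circ₁ 0 (by omega) j hj'.le (Or.inr ⟨by push_cast; omega, by push_cast; omega⟩)) (v 0)
        rw [← hE, LinearMap.zero_apply, Module.End.mul_apply, Module.End.mul_apply] at h0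
        rw [h0, smul_zero]
      · interval_cases j <;> simp
    · simp
  have hzero : E 0 (Φ.As w) = 0 := by
    have hA0 := hA 0 (by omega)
    have hA1 := hA 1 (by omega)
    have hAs1 := hAs 1 le_rfl (by omega)
    have hAs2 := hAs 2 (by omega) (by omega)
    have hE1 := hstep 0 (by omega) 0 (by omega)
    have hE2 := hstep 0 (by omega) 1 (by omega)
    simp only [Nat.sub_zero, zero_add, Nat.reduceAdd, Nat.sub_self, Nat.reduceSub]
      at hA0 hA1 hAs1 hAs2 hE1 hE2
    simp only [hw, hA0, hA1, hAs0, hAs1, hAs2, hE1, hE2, map_sub, map_add, map_smul]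
    rw [vth, vth, if_pos ⟨le_rfl, by omega⟩, if_pos ⟨by omega, by omega⟩,
      Nat.sub_add_cancel (by omega), show d - 2 + 1 = d - 1 by omega] at hz
    refine Eq.trans ?_ (zero_smul F (E 0 (v 0)))
    rw [← hz]
    module
  rw [hzero, eq_comm, smul_eq_zero, mul_eq_zero, sub_eq_zero, sub_eq_zero] at hsum
  rcases hsum with (h | h) | h
  · have := Φ.θ_inj _ le_rfl _ (by omega) h
    omega
  · have := Φ.θ_inj _ le_rfl _ (by omega) h
    omega
  · exact h

/-- For a `β`-recurrent system, the parameter `β` is tied to `d`. -/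
lemma betaSeq_eq_one {n : ℕ} (Φ : CHSystem F V (n + 3)) {φ : ℕ → F} {β : F}
    (hsplit : SplitSeq (n + 3) Φ.A Φ.As Φ.θ Φ.θs φ) (hθ : BetaRecurrent β (n + 3) Φ.θ)
    (hv : BetaRecurrent β (n + 3 + 1) (vth (n + 3) Φ.θ Φ.θs φ)) :
    betaSeq β (n + 2) = 1 := by
  have hne := Φ.vth_ne (by omega) hsplit
  set ϑ := vth (n + 3) Φ.θ Φ.θs φ with hϑ
  have h0 : ϑ 0 = 0 := by simp [hϑ, vth]
  have hlast : ϑ (n + 3 + 1) = 0 := by simp [hϑ, vth]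
  have ht : betaSeq β (n + 2) ≠ 0 := hθ.betaSeq_ne_zero Φ.θ_inj (n + 1) (by omega)
  have hrel := hv.eq_betaSeq (n + 3) le_rfl
  rw [hlast, h0] at hrel
  have hθrel := hθ.betaSeq_mul_sub (n + 1) le_rfl
  simp only [Nat.add_assoc, Nat.reduceAdd] at hθrel hrel
  rw [show n + 3 - 1 = n + 2 by omega] at hne
  have hm := betaSeq_mul_add_two β (n + 2)
  simp only [Nat.add_assoc, Nat.reduceAdd] at hm
  have h3 : betaSeq β (n + 3) = β * betaSeq β (n + 2) - betaSeq β (n + 1) + 1 := rfl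
  have hzero : betaSeq β (n + 3) = 0 := by
    by_contra hc
    refine hne ?_
    have hX : (ϑ 2 - (β + 1) * ϑ 1) * betaSeq β (n + 2) + ϑ 1 * (betaSeq β (n + 3) - 1) = 0 := by
      refine (mul_eq_zero.1 ?_).resolve_left hc
      linear_combination -betaSeq β (n + 2) * hrel - ϑ 1 * hm
    refine (mul_eq_zero.1 ?_).resolve_left ht
    linear_combination (Φ.θ 0 - Φ.θ (n + 3)) * hX - ϑ 1 * hθrel
      - (Φ.θ 0 - Φ.θ (n + 3)) * ϑ 1 * h3
  have hinv := betaSeq_invariant β (n + 2)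
  simp only [Nat.add_assoc, Nat.reduceAdd] at hinv
  rw [hzero] at hinv
  refine mul_left_cancel₀ ht ?_
  linear_combination hinv

end CHSystem

/-- two telescoping-type products equal 1 for a recurrent CH system. -/
theorem stmt16 {F V : Type*} [Field F] [AddCommGroup V] [Module F V]
    (d : ℕ) (hd : 3 ≤ d) (hdim : Module.finrank F V = d + 1)
    (Φ : CHSystem F V d) (φ : ℕ → F)
    (hφ0 : ∀ i, 1 ≤ i → i ≤ d → φ i ≠ 0)
    (hsplit : SplitSeq d Φ.A Φ.As Φ.θ Φ.θs φ)
    (hrec : ∃ β : F, BetaRecurrent β d Φ.θ ∧ BetaRecurrent β d Φ.θs ∧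
      BetaRecurrent β (d+1) (vth d Φ.θ Φ.θs φ)) :
    (∏ i ∈ Finset.Icc 2 (d-1), (Φ.θ 0 - Φ.θ (i+1)) / (Φ.θ 1 - Φ.θ i)) = 1 ∧
    (∏ i ∈ Finset.Icc 2 (d-1), (Φ.θs 0 - Φ.θs (i+1)) / (Φ.θs 1 - Φ.θs i)) = 1 := by
  obtain ⟨β, hθ, hθs, hv⟩ := hrec
  obtain ⟨n, rfl⟩ := Nat.exists_eq_add_of_le' hd
  have h1 := Φ.betaSeq_eq_one hsplit hθ hv
  exact ⟨(hθ.prod_div_eq_betaSeq Φ.θ_inj (n + 1) le_rfl).trans h1,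
    (hθs.prod_div_eq_betaSeq Φ.θs_inj (n + 1) le_rfl).trans h1⟩
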